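/- arXiv:1405.4880 — 3 statements merged into one kernel-verified Lean document; each statement's English description precedes it below -/
import Mathlib

section
/- Let G be a cycle graph on 2n+1 vertices, n ≥ 1. The acyclic orientations of G that maximize the number of linear extensions of the induced poset are exactly the almost bipartite orientations, i.e., acyclic orientations containing exactly one directed 2-path (exactly one vertex with in-degree and out-degree patterns giving a configuration (u,v),(v,w)). -/
/-- An orientation of a simple graph `G`: a choice of direction for each edge. -/
structure GraphOrientation {V : Type*} (G : SimpleGraph V) where
  dir : V → V → Prop
  dir_adj : ∀ u v, dir u v → G.Adj u v
  adj_dir : ∀ u v, G.Adj u v → dir u v ∨ dir v u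
  asymm : ∀ u v, dir u v → ¬ dir v u

/-- An orientation is acyclic if there is no directed cycle. -/
def GraphOrientation.Acyclic {V : Type*} {G : SimpleGraph V} (O : GraphOrientation G) : Prop :=
  ∀ v, ¬ Relation.TransGen O.dir v v

/-- Linear extensions of the poset induced (by reachability) by an orientation:
bijective labelings of the vertices by `Fin (card V)` compatible with directed paths. -/
def GraphOrientation.LinExt {V : Type*} [Fintype V] {G : SimpleGraph V} (O : GraphOrientation G) :
    Type _ :=
  {f : V ≃ Fin (Fintype.card V) // ∀ u v, Relation.TransGen O.dir u v → f u < f v}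

/-- The number of linear extensions of the poset induced by an orientation. -/
noncomputable def GraphOrientation.numLinExt {V : Type*} [Fintype V] {G : SimpleGraph V}
    (O : GraphOrientation G) : ℕ :=
  Nat.card O.LinExt


/-- The cycle graph on the vertex set `ZMod m`: `i` adjacent to `j` iff they differ by 1. -/
def cycleGraphZMod (m : ℕ) : SimpleGraph (ZMod m) :=
  SimpleGraph.fromRel (fun i j => i - j = 1)

/-- An acyclic orientation of an odd cycle is almost bipartite if it has exactly one
directed 2-path `(u,v), (v,w)`. -/
def GraphOrientation.AlmostBipartite {V : Type*} {G : SimpleGraph V}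
    (O : GraphOrientation G) : Prop :=
  ∃! t : V × V × V, O.dir t.1 t.2.1 ∧ O.dir t.2.1 t.2.2


namespace LEx
open Classical Finset

variable {V : Type*}

noncomputable def mx (r : V → V → Prop) (S : Finset V) : Finset V :=
  S.filter (fun x => ∀ y ∈ S, ¬ r x y)

def LE (r : V → V → Prop) (S : Finset V) : Type _ :=
  {f : V → ℕ // (∀ x, x ∉ S → f x = 0) ∧ (∀ x ∈ S, f x < S.card) ∧
    (∀ x ∈ S, ∀ y ∈ S, f x = f y → x = y) ∧ (∀ x ∈ S, ∀ y ∈ S, r x y → f x < f y)}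

noncomputable def ext (r : V → V → Prop) (S : Finset V) : ℕ := Nat.card (LE r S)

lemma mem_mx {r : V → V → Prop} {S : Finset V} {x : V} :
    x ∈ mx r S ↔ x ∈ S ∧ ∀ y ∈ S, ¬ r x y := by simp [mx]

noncomputable def step (r : V → V → Prop) (hi : ∀ a, ¬ r a a) (S : Finset V) :
    (Σ m : {x // x ∈ mx r S}, LE r (S.erase m.1)) → LE r S := fun p =>
  ⟨Function.update p.2.1 p.1.1 (S.card - 1), by
    obtain ⟨⟨m, hm⟩, f, h1, h2, h3, h4⟩ := p
    have hm' := mem_mx.1 hm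
    have hc := card_erase_of_mem hm'.1
    have hpos : 0 < S.card := card_pos.2 ⟨m, hm'.1⟩
    simp only [hc, mem_erase] at h1 h2 h3 h4
    refine ⟨?_, ?_, ?_, ?_⟩
    · intro x hx
      have : x ≠ m := fun h => hx (h ▸ hm'.1)
      simp only [Function.update_of_ne this]
      exact h1 x (fun h => hx h.2)
    · intro x hx
      by_cases h : x = m
      · subst h
        simp only [Function.update_self]
        omega
      · simp only [Function.update_of_ne h]
        have := h2 x ⟨h, hx⟩
        omega
    · intro x hx y hy hxy
      by_cases h : x = m <;> by_cases h' : y = m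
      · rw [h, h']
      · subst h
        have := h2 y ⟨h', hy⟩
        simp [Function.update_of_ne h'] at hxy
        omega
      · subst h'
        have := h2 x ⟨h, hx⟩
        simp [Function.update_of_ne h] at hxy
        omega
      · simp [Function.update_of_ne h, Function.update_of_ne h'] at hxy
        exact h3 x ⟨h, hx⟩ y ⟨h', hy⟩ hxy
    · intro x hx y hy hxy
      by_cases h : x = m
      · subst h; exact absurd hxy (hm'.2 y hy)
      · by_cases h' : y = m
        · subst h'
          have := h2 x ⟨h, hx⟩
          simpa [Function.update_of_ne h] using this
        · simpa [Function.update_of_ne h, Function.update_of_ne h'] using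
            h4 x ⟨h, hx⟩ y ⟨h', hy⟩ hxy⟩

lemma step_bij (r : V → V → Prop) (hi : ∀ a, ¬ r a a) (S : Finset V) (hS : S.Nonempty) :
    Function.Bijective (step r hi S) := by
  constructor
  · rintro ⟨⟨m, hm⟩, f, h1, h2, h3, h4⟩ ⟨⟨m', hm'⟩, f', h1', h2', h3', h4'⟩ h
    have h := congrArg Subtype.val h
    simp only [step] at h
    have hmS := (mem_mx.1 hm).1
    have hmS' := (mem_mx.1 hm').1
    have hmm : m = m' := by
      by_contra hne
      have e := congrFun h m
      simp only [Function.update_self, Function.update_of_ne hne] at e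
      have := h2' m (mem_erase.2 ⟨hne, hmS⟩)
      rw [card_erase_of_mem hmS'] at this
      omega
    subst hmm
    have : f = f' := by
      funext x
      by_cases hx : x = m
      · subst hx
        rw [h1 x (by simp), h1' x (by simp)]
      · have e := congrFun h x
        simpa [Function.update_of_ne hx] using e
    subst this
    rfl
  · rintro ⟨f, h1, h2, h3, h4⟩
    have hpos : 0 < S.card := card_pos.2 hS
    obtain ⟨m, hm, hfm⟩ : ∃ m ∈ S, f m = S.card - 1 := by
      have himg : S.image f = range S.card := by
        apply eq_of_subset_of_card_le
        · intro y hy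
          obtain ⟨x, hx, rfl⟩ := mem_image.1 hy
          exact mem_range.2 (h2 x hx)
        · rw [card_image_of_injOn (fun x hx y hy h => h3 x hx y hy h)]
          simp
      have : S.card - 1 ∈ S.image f := by rw [himg]; simp; omega
      simpa using this
    have hmx : m ∈ mx r S := by
      refine mem_mx.2 ⟨hm, fun y hy hr => ?_⟩
      have a := h4 m hm y hy hr
      have b := h2 y hy
      omega
    have hc := card_erase_of_mem hm
    refine ⟨⟨⟨m, hmx⟩, ⟨Function.update f m 0, ?_, ?_, ?_, ?_⟩⟩, ?_⟩
    · intro x hx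
      by_cases h : x = m
      · subst h; simp
      · simp only [Function.update_of_ne h]
        exact h1 x (fun h' => hx (mem_erase.2 ⟨h, h'⟩))
    · intro x hx
      obtain ⟨h, hx⟩ := mem_erase.1 hx
      simp only [Function.update_of_ne h]
      have a := h2 x hx
      have : f x ≠ f m := fun e => h (h3 x hx m hm e)
      show f x < (S.erase m).card
      omega
    · intro x hx y hy hxy
      obtain ⟨h, hx⟩ := mem_erase.1 hx
      obtain ⟨h', hy⟩ := mem_erase.1 hy
      simp only [Function.update_of_ne h, Function.update_of_ne h'] at hxy
      exact h3 x hx y hy hxy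
    · intro x hx y hy hxy
      obtain ⟨h, hx⟩ := mem_erase.1 hx
      obtain ⟨h', hy⟩ := mem_erase.1 hy
      simp only [Function.update_of_ne h, Function.update_of_ne h']
      exact h4 x hx y hy hxy
    · apply Subtype.ext
      simp [step, ← hfm]

instance LE_finite (r : V → V → Prop) (S : Finset V) : Finite (LE r S) := by
  have : Function.Injective (fun (f : LE r S) (x : S) => (⟨f.1 x, f.2.2.1 x x.2⟩ : Fin S.card)) := by
    intro f g h
    apply Subtype.ext
    funext x
    by_cases hx : x ∈ S
    · have := congrFun h ⟨x, hx⟩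
      simpa using this
    · rw [f.2.1 x hx, g.2.1 x hx]
  exact Finite.of_injective _ this

lemma ext_empty (r : V → V → Prop) : ext r ∅ = 1 := by
  unfold ext
  rw [Nat.card_eq_one_iff_unique]
  refine ⟨⟨fun f g => Subtype.ext (funext fun x => ?_)⟩, ⟨⟨fun _ => 0, by simp⟩⟩⟩
  rw [f.2.1 x (by simp), g.2.1 x (by simp)]

lemma ext_rec (r : V → V → Prop) (hi : ∀ a, ¬ r a a) (S : Finset V) (hS : S.Nonempty) :
    ext r S = ∑ m ∈ mx r S, ext r (S.erase m) := by
  unfold ext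
  rw [← Nat.card_congr (Equiv.ofBijective _ (step_bij r hi S hS)), Nat.card_sigma]
  exact Finset.sum_coe_sort (mx r S) (fun m => Nat.card (LE r (S.erase m)))

lemma exists_mx {r : V → V → Prop} (ht : ∀ a b c, r a b → r b c → r a c) (hi : ∀ a, ¬ r a a)
    (S : Finset V) : ∀ (k : ℕ) (x : V), x ∈ S → (S.filter (fun y => r x y)).card = k →
    ∃ m ∈ mx r S, x = m ∨ r x m := by
  intro k
  induction k using Nat.strong_induction_on with
  | _ k ih =>
    intro x hx hk
    by_cases h : ∀ y ∈ S, ¬ r x y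
    · exact ⟨x, mem_mx.2 ⟨hx, h⟩, Or.inl rfl⟩
    · push Not at h
      obtain ⟨y, hy, hxy⟩ := h
      have hlt : (S.filter (fun z => r y z)).card < k := by
        rw [← hk]
        apply card_lt_card
        refine ⟨fun z hz => ?_, fun hs => ?_⟩
        · simp only [mem_filter] at hz ⊢
          exact ⟨hz.1, ht _ _ _ hxy hz.2⟩
        · have := hs (mem_filter.2 ⟨hy, hxy⟩)
          exact hi _ (mem_filter.1 this).2
      obtain ⟨m, hm, h⟩ := ih _ hlt y hy rfl
      refine ⟨m, hm, Or.inr ?_⟩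
      rcases h with rfl | h
      · exact hxy
      · exact ht _ _ _ hxy h

lemma ext_pos {r : V → V → Prop} (ht : ∀ a b c, r a b → r b c → r a c) (hi : ∀ a, ¬ r a a) :
    ∀ (k : ℕ) (S : Finset V), S.card = k → 0 < ext r S := by
  intro k
  induction k with
  | zero => intro S hS; rw [card_eq_zero.1 hS, ext_empty]; norm_num
  | succ k ih =>
    intro S hS
    have hne : S.Nonempty := card_pos.1 (by omega)
    obtain ⟨x, hx⟩ := hne
    rw [ext_rec r hi S ⟨x, hx⟩]
    obtain ⟨m, hm, -⟩ := exists_mx ht hi S _ x hx rfl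
    apply sum_pos
    · intro i hi'
      apply ih
      rw [card_erase_of_mem (mem_mx.1 hi').1]; omega
    · exact ⟨m, hm⟩

noncomputable def up (r : V → V → Prop) (S A : Finset V) : Finset V :=
  (mx r S).filter (fun u => ∃ a ∈ A, a = u ∨ r a u)

lemma mem_up {r : V → V → Prop} {S A : Finset V} {x : V} :
    x ∈ up r S A ↔ x ∈ mx r S ∧ ∃ a ∈ A, a = x ∨ r a x := by simp [up]

lemma mx_erase {r : V → V → Prop} (ht : ∀ a b c, r a b → r b c → r a c) (hi : ∀ a, ¬ r a a)
    {S : Finset V} {x : V} (hx : x ∈ S) (hn : x ∉ mx r S) : mx r (S.erase x) = mx r S := by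
  have : ∃ y ∈ S, r x y := by
    by_contra h; push Not at h; exact hn (mem_mx.2 ⟨hx, h⟩)
  obtain ⟨y, hy, hxy⟩ := this
  ext z
  simp only [mem_mx, mem_erase]
  constructor
  · rintro ⟨⟨hz, hzS⟩, h⟩
    refine ⟨hzS, fun w hw hr => ?_⟩
    by_cases e : w = x
    · subst e
      exact h y ⟨fun e => hi w (by rw [e] at hxy; exact e ▸ hxy), hy⟩ (ht _ _ _ hr hxy)
    · exact h w ⟨e, hw⟩ hr
  · rintro ⟨hzS, h⟩
    refine ⟨⟨fun e => hn ?_, hzS⟩, fun w hw => h w hw.2⟩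
    subst e; exact mem_mx.2 ⟨hzS, h⟩

lemma antichain_up {r : V → V → Prop} (ht : ∀ a b c, r a b → r b c → r a c) (hi : ∀ a, ¬ r a a) :
    ∀ (k : ℕ) (S A : Finset V), S.card = k → A ⊆ S → (∀ a ∈ A, ∀ b ∈ A, ¬ r a b) →
    ∑ x ∈ A, ext r (S.erase x) ≤ ∑ u ∈ up r S A, ext r (S.erase u) := by
  intro k
  induction k with
  | zero =>
    intro S A hS hA _
    rw [card_eq_zero.1 hS, subset_empty] at hA
    simp [hA]
  | succ k ih =>
    -- first the case where no element of the antichain is maximal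
    have key : ∀ (S B : Finset V), S.card = k + 1 → B ⊆ S → (∀ a ∈ B, ∀ b ∈ B, ¬ r a b) →
        (∀ a ∈ B, a ∉ mx r S) →
        ∑ x ∈ B, ext r (S.erase x) ≤ ∑ u ∈ up r S B, ext r (S.erase u) := by
      intro S B hS hB hanti hnm
      set U := up r S B with hU
      have h1 : ∑ x ∈ B, ext r (S.erase x)
          = ∑ m ∈ mx r S, ∑ x ∈ B, ext r ((S.erase m).erase x) := by
        rw [sum_comm]
        apply sum_congr rfl
        intro x hx
        obtain ⟨m, hm, hxm⟩ := exists_mx ht hi S _ x (hB hx) rfl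
        have hne : m ≠ x := fun e => hnm x hx (e ▸ hm)
        rw [ext_rec r hi _ ⟨m, mem_erase.2 ⟨hne, (mem_mx.1 hm).1⟩⟩, mx_erase ht hi (hB hx) (hnm x hx)]
        apply sum_congr rfl
        intro m _
        rw [erase_right_comm]
      have h2 : ∀ m ∈ mx r S, ∑ x ∈ B, ext r ((S.erase m).erase x)
          ≤ ∑ u ∈ up r (S.erase m) B, ext r ((S.erase m).erase u) := by
        intro m hm
        apply ih
        · rw [card_erase_of_mem (mem_mx.1 hm).1]; omega
        · intro b hb
          exact mem_erase.2 ⟨fun e => hnm b hb (e ▸ hm), hB hb⟩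
        · exact hanti
      have h3 : ∀ m ∈ mx r S \ U, up r (S.erase m) B ⊆ U := by
        intro m hm u hu
        obtain ⟨hm, hmU⟩ := mem_sdiff.1 hm
        obtain ⟨hu, a, ha, hau⟩ := mem_up.1 hu
        obtain ⟨huS, hu⟩ := mem_mx.1 hu
        obtain ⟨hum, huS⟩ := mem_erase.1 huS
        refine mem_up.2 ⟨mem_mx.2 ⟨huS, fun y hy hr => ?_⟩, a, ha, hau⟩
        by_cases e : y = m
        · subst e
          refine hmU (mem_up.2 ⟨hm, a, ha, Or.inr ?_⟩)
          rcases hau with rfl | h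
          · exact hr
          · exact ht _ _ _ h hr
        · exact hu y (mem_erase.2 ⟨e, hy⟩) hr
      have hUsub : U ⊆ mx r S := filter_subset _ _
      have h4 : ∀ u ∈ U, ∑ m ∈ mx r S \ U, ext r ((S.erase m).erase u)
          + ∑ m ∈ up r (S.erase u) B, ext r ((S.erase u).erase m) ≤ ext r (S.erase u) := by
        intro u hu
        obtain ⟨hum, a, ha, hau⟩ := mem_up.1 hu
        have hne : a ≠ u := fun e => hnm a ha (e ▸ hum)
        rw [ext_rec r hi (S.erase u) ⟨a, mem_erase.2 ⟨hne, hB ha⟩⟩]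
        have hd : Disjoint (mx r S \ U) (up r (S.erase u) B) := by
          rw [disjoint_left]
          intro x hx hx'
          obtain ⟨hx1, hx2⟩ := mem_sdiff.1 hx
          exact hx2 (mem_up.2 ⟨hx1, (mem_up.1 hx').2⟩)
        have e1 : ∑ m ∈ mx r S \ U, ext r ((S.erase m).erase u)
            = ∑ m ∈ mx r S \ U, ext r ((S.erase u).erase m) :=
          sum_congr rfl fun m _ => by rw [erase_right_comm]
        rw [e1, ← sum_union hd]
        apply sum_le_sum_of_subset
        intro x hx
        rcases mem_union.1 hx with hx | hx
        · obtain ⟨hx1, hx2⟩ := mem_sdiff.1 hx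
          obtain ⟨hxS, hx1⟩ := mem_mx.1 hx1
          refine mem_mx.2 ⟨mem_erase.2 ⟨fun e => hx2 (e ▸ hu), hxS⟩, fun y hy => hx1 y (mem_erase.1 hy).2⟩
        · exact (mem_up.1 hx).1
      calc ∑ x ∈ B, ext r (S.erase x)
          ≤ ∑ m ∈ mx r S, ∑ u ∈ up r (S.erase m) B, ext r ((S.erase m).erase u) := by
            rw [h1]; exact sum_le_sum h2
        _ = ∑ m ∈ mx r S \ U, ∑ u ∈ up r (S.erase m) B, ext r ((S.erase m).erase u)
            + ∑ m ∈ U, ∑ u ∈ up r (S.erase m) B, ext r ((S.erase m).erase u) :=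
            (sum_sdiff hUsub).symm
        _ ≤ ∑ m ∈ mx r S \ U, ∑ u ∈ U, ext r ((S.erase m).erase u)
            + ∑ m ∈ U, ∑ u ∈ up r (S.erase m) B, ext r ((S.erase m).erase u) := by
            apply Nat.add_le_add_right
            exact sum_le_sum fun m hm => sum_le_sum_of_subset (h3 m hm)
        _ = ∑ u ∈ U, (∑ m ∈ mx r S \ U, ext r ((S.erase m).erase u)
            + ∑ m ∈ up r (S.erase u) B, ext r ((S.erase u).erase m)) := by
            rw [sum_comm, sum_add_distrib]
        _ ≤ _ := sum_le_sum h4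
    intro S A hS hA hanti
    have hB := key S (A \ mx r S) hS (sdiff_subset.trans hA)
      (fun a ha b hb => hanti a (mem_sdiff.1 ha).1 b (mem_sdiff.1 hb).1)
      (fun a ha => (mem_sdiff.1 ha).2)
    have hd : Disjoint (up r S (A \ mx r S)) (A ∩ mx r S) := by
      rw [disjoint_left]
      intro x hx hx'
      obtain ⟨hx1, a, ha, hax⟩ := mem_up.1 hx
      rcases hax with rfl | h
      · exact (mem_sdiff.1 ha).2 hx1
      · exact hanti a (mem_sdiff.1 ha).1 x (mem_inter.1 hx').1 h
    calc ∑ x ∈ A, ext r (S.erase x)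
        = ∑ x ∈ A \ mx r S, ext r (S.erase x) + ∑ x ∈ A ∩ mx r S, ext r (S.erase x) := by
          rw [← sdiff_inter_self_left, sum_sdiff inter_subset_left]
      _ ≤ ∑ x ∈ up r S (A \ mx r S), ext r (S.erase x) + ∑ x ∈ A ∩ mx r S, ext r (S.erase x) :=
          Nat.add_le_add_right hB _
      _ = ∑ x ∈ up r S (A \ mx r S) ∪ (A ∩ mx r S), ext r (S.erase x) := (sum_union hd).symm
      _ ≤ _ := by
          apply sum_le_sum_of_subset
          intro x hx
          rcases mem_union.1 hx with hx | hx
          · obtain ⟨hx1, a, ha, hax⟩ := mem_up.1 hx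
            exact mem_up.2 ⟨hx1, a, (mem_sdiff.1 ha).1, hax⟩
          · exact mem_up.2 ⟨(mem_inter.1 hx).2, x, (mem_inter.1 hx).1, Or.inl rfl⟩

lemma antichain_le {r : V → V → Prop} (ht : ∀ a b c, r a b → r b c → r a c) (hi : ∀ a, ¬ r a a)
    (S A : Finset V) (hS : S.Nonempty) (hA : A ⊆ S) (hanti : ∀ a ∈ A, ∀ b ∈ A, ¬ r a b) :
    ∑ x ∈ A, ext r (S.erase x) ≤ ext r S := by
  rw [ext_rec r hi S hS]
  exact (antichain_up ht hi _ S A rfl hA hanti).trans (sum_le_sum_of_subset (filter_subset _ _))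

lemma erase_le {r : V → V → Prop} (ht : ∀ a b c, r a b → r b c → r a c) (hi : ∀ a, ¬ r a a)
    (S : Finset V) (b : V) (hb : b ∈ S) : ext r (S.erase b) ≤ ext r S := by
  have := antichain_le ht hi S {b} ⟨b, hb⟩ (by simpa using hb) (by simpa using hi b)
  simpa using this

lemma erase_lt {r : V → V → Prop} (ht : ∀ a b c, r a b → r b c → r a c) (hi : ∀ a, ¬ r a a) :
    ∀ (k : ℕ) (S : Finset V) (a b : V), S.card = k → a ∈ S → b ∈ S → a ≠ b → ¬ r a b → ¬ r b a →
    ext r (S.erase b) < ext r S := by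
  intro k
  induction k with
  | zero => intro S a b hS ha; rw [card_eq_zero.1 hS] at ha; simp at ha
  | succ k ih =>
    intro S a b hS ha hb hab h1 h2
    by_cases hbm : b ∈ mx r S
    · obtain ⟨m, hm, ham⟩ := exists_mx ht hi S _ a ha rfl
      have hmb : m ≠ b := by
        rintro rfl
        rcases ham with h | h
        · exact hab h
        · exact h1 h
      rw [ext_rec r hi S ⟨a, ha⟩, ← add_sum_erase _ _ hbm]
      have : 0 < ∑ x ∈ (mx r S).erase b, ext r (S.erase x) :=
        sum_pos (fun i _ => ext_pos ht hi _ _ rfl) ⟨m, mem_erase.2 ⟨hmb, hm⟩⟩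
      omega
    · rw [ext_rec r hi S ⟨a, ha⟩, ext_rec r hi (S.erase b) ⟨a, mem_erase.2 ⟨hab, ha⟩⟩,
        mx_erase ht hi hb hbm]
      obtain ⟨m, hm, hbm'⟩ := exists_mx ht hi S _ b hb rfl
      have hma : m ≠ a := by
        rintro rfl
        rcases hbm' with h | h
        · exact hab h.symm
        · exact h2 h
      have hne : ∀ i ∈ mx r S, b ≠ i := fun i hi e => hbm (e ▸ hi)
      apply sum_lt_sum
      · intro i hi'
        rw [erase_right_comm]
        exact erase_le ht hi _ _ (mem_erase.2 ⟨hne i hi', hb⟩)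
      · refine ⟨m, hm, ?_⟩
        rw [erase_right_comm]
        refine ih _ a b ?_ (mem_erase.2 ⟨hma.symm, ha⟩) (mem_erase.2 ⟨hne m hm, hb⟩) hab h1 h2
        rw [card_erase_of_mem (mem_mx.1 hm).1]; omega

lemma comp_le {p q : V → V → Prop}
    (hpi : ∀ a, ¬ p a a)
    (hqt : ∀ a b c, q a b → q b c → q a c) (hqi : ∀ a, ¬ q a a)
    (hc : ∀ a b, q a b → p a b ∨ p b a) :
    ∀ (k : ℕ) (S : Finset V), S.card = k → ext p S ≤ ext q S := by
  intro k
  induction k with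
  | zero => intro S hS; rw [card_eq_zero.1 hS, ext_empty, ext_empty]
  | succ k ih =>
    intro S hS
    have hne : S.Nonempty := card_pos.1 (by omega)
    rw [ext_rec p hpi S hne]
    refine le_trans (sum_le_sum fun m hm => ih (S.erase m) ?_)
      (antichain_le hqt hqi S (mx p S) hne (filter_subset _ _) ?_)
    · rw [card_erase_of_mem (mem_mx.1 hm).1]; omega
    · intro a ha b hb hab
      rcases hc a b hab with h | h
      · exact (mem_mx.1 ha).2 b (mem_mx.1 hb).1 h
      · exact (mem_mx.1 hb).2 a (mem_mx.1 ha).1 h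

lemma comp_lt {p q : V → V → Prop}
    (hpi : ∀ a, ¬ p a a)
    (hqt : ∀ a b c, q a b → q b c → q a c) (hqi : ∀ a, ¬ q a a)
    (hc : ∀ a b, q a b → p a b ∨ p b a) (a b : V) (hab : p a b) (h1 : ¬ q a b) (h2 : ¬ q b a) :
    ∀ (k : ℕ) (S : Finset V), S.card = k → a ∈ S → b ∈ S → ext p S < ext q S := by
  intro k
  induction k with
  | zero => intro S hS ha; rw [card_eq_zero.1 hS] at ha; simp at ha
  | succ k ih =>
    intro S hS ha hb
    have hne : S.Nonempty := ⟨a, ha⟩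
    have hanti : ∀ x ∈ mx p S, ∀ y ∈ mx p S, ¬ q x y := by
      intro a ha b hb hab
      rcases hc a b hab with h | h
      · exact (mem_mx.1 ha).2 b (mem_mx.1 hb).1 h
      · exact (mem_mx.1 hb).2 a (mem_mx.1 ha).1 h
    rw [ext_rec p hpi S hne]
    by_cases hx : ∃ x ∈ mx p S, x ≠ b
    · obtain ⟨x, hx, hxb⟩ := hx
      have hxa : x ≠ a := fun e => (mem_mx.1 hx).2 b hb (e ▸ hab)
      refine lt_of_lt_of_le (sum_lt_sum (fun m _ => comp_le hpi hqt hqi hc _ (S.erase m) rfl)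
        ⟨x, hx, ih _ ?_ (mem_erase.2 ⟨hxa.symm, ha⟩) (mem_erase.2 ⟨hxb.symm, hb⟩)⟩)
        (antichain_le hqt hqi S (mx p S) hne (filter_subset _ _) hanti)
      rw [card_erase_of_mem (mem_mx.1 hx).1]; omega
    · push Not at hx
      have hsub : mx p S ⊆ {b} := fun x h => mem_singleton.2 (hx x h)
      calc ∑ m ∈ mx p S, ext p (S.erase m) ≤ ∑ m ∈ {b}, ext p (S.erase m) :=
            sum_le_sum_of_subset hsub
        _ = ext p (S.erase b) := by simp
        _ ≤ ext q (S.erase b) := comp_le hpi hqt hqi hc _ _ rfl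
        _ < ext q S := erase_lt hqt hqi _ S a b rfl ha hb
            (fun e => hpi b (by rw [e] at hab; exact hab)) h1 h2

lemma numLinExt_eq [Fintype V] {G : SimpleGraph V} (O : GraphOrientation G) :
    O.numLinExt = ext (Relation.TransGen O.dir) univ := by
  unfold GraphOrientation.numLinExt ext
  apply Nat.card_congr
  refine Equiv.ofBijective (fun f => ⟨fun x => (f.1 x : ℕ), by simp, ?_, ?_, ?_⟩) ⟨?_, ?_⟩
  · intro x _; simp [card_univ]
  · intro x _ y _ h
    exact f.1.injective (Fin.ext h)
  · intro x _ y _ h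
    exact f.2 x y h
  · intro f g h
    have h := congrArg Subtype.val h
    apply Subtype.ext
    apply Equiv.ext
    intro x
    exact Fin.ext (congrFun h x)
  · rintro ⟨f, h1, h2, h3, h4⟩
    let g : V → Fin (Fintype.card V) := fun x => ⟨f x, h2 x (mem_univ x)⟩
    have hg : Function.Bijective g := by
      rw [Fintype.bijective_iff_injective_and_card]
      refine ⟨fun x y h => h3 x (mem_univ _) y (mem_univ _) (congrArg Fin.val h), by simp⟩
    refine ⟨⟨Equiv.ofBijective g hg, fun u v h => ?_⟩, ?_⟩
    · exact h4 u (mem_univ _) v (mem_univ _) h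
    · rfl

end LEx

namespace LEx
open Relation

lemma trans_mid {V : Type*} {G : SimpleGraph V} (O : GraphOrientation G) (c : V)
    (h : ∀ u v w, O.dir u v → O.dir v w → v = c) (u v : V) (huv : TransGen O.dir u v) :
    O.dir u v ∨ (O.dir u c ∧ O.dir c v) := by
  induction huv with
  | single h => exact Or.inl h
  | tail _ hvw ih =>
    rename_i v w _
    rcases ih with h1 | ⟨h1, h2⟩
    · have := h _ _ _ h1 hvw
      subst this
      exact Or.inr ⟨h1, hvw⟩
    · have := h _ _ _ h2 hvw
      subst this
      exact absurd h2 (O.asymm _ _ h2)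

lemma adj_iff {m : ℕ} (a b : ZMod m) :
    (cycleGraphZMod m).Adj a b ↔ a ≠ b ∧ (a - b = 1 ∨ b - a = 1) := by
  simp [cycleGraphZMod, SimpleGraph.fromRel_adj]

lemma nbr {m : ℕ} {a b : ZMod m} (h : (cycleGraphZMod m).Adj a b) : a = b + 1 ∨ a = b - 1 := by
  rcases (adj_iff a b).1 h with ⟨_, h | h⟩
  · left; rw [← h]; ring
  · right; rw [← h]; ring

lemma comp_of_double {m : ℕ} (P Q : GraphOrientation (cycleGraphZMod m)) (c u' w' : ZMod m)
    (hQ : ∀ u v w, Q.dir u v → Q.dir v w → v = c) (h1 : P.dir u' c) (h2 : P.dir c w')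
    (a b : ZMod m) (hab : TransGen Q.dir a b) : TransGen P.dir a b ∨ TransGen P.dir b a := by
  rcases trans_mid Q c hQ a b hab with h | ⟨ha, hb⟩
  · rcases P.adj_dir _ _ (Q.dir_adj _ _ h) with h | h
    · exact Or.inl (.single h)
    · exact Or.inr (.single h)
  · have na := nbr (Q.dir_adj _ _ ha)
    have nb := nbr (Q.dir_adj _ _ hb).symm
    have nu := nbr (P.dir_adj _ _ h1)
    have nw := nbr (P.dir_adj _ _ h2).symm
    have hne : a ≠ b := by rintro rfl; exact Q.asymm _ _ ha hb
    have hne' : u' ≠ w' := by rintro rfl; exact P.asymm _ _ h1 h2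
    have key : TransGen P.dir u' w' := .tail (.single h1) h2
    rcases na with rfl | rfl <;> rcases nb with rfl | rfl <;> rcases nu with rfl | rfl <;>
      rcases nw with rfl | rfl <;>
      first
      | exact absurd rfl hne
      | exact absurd rfl hne'
      | exact Or.inl key
      | exact Or.inr key

lemma one_ne {n : ℕ} (hn : 1 ≤ n) : (1 : ZMod (2 * n + 1)) ≠ 0 := by
  have : Fact (1 < 2 * n + 1) := ⟨by omega⟩
  exact one_ne_zero

lemma adj_succ {n : ℕ} (hn : 1 ≤ n) (i : ZMod (2 * n + 1)) :
    (cycleGraphZMod (2 * n + 1)).Adj i (i + 1) := by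
  rw [adj_iff]
  refine ⟨fun h => one_ne hn ?_, Or.inr (by ring)⟩
  simpa using h.symm

lemma exists_double {n : ℕ} (hn : 1 ≤ n) (O : GraphOrientation (cycleGraphZMod (2 * n + 1))) :
    ∃ u v w, O.dir u v ∧ O.dir v w := by
  by_contra hcon
  push Not at hcon
  have hs : ∀ i, O.dir (i + 1) (i + 1 + 1) ↔ ¬ O.dir i (i + 1) := by
    intro i
    constructor
    · intro h h'; exact hcon _ _ _ h' h
    · intro h
      have h1 := (O.adj_dir _ _ (adj_succ hn i)).resolve_left h
      rcases O.adj_dir _ _ (adj_succ hn (i + 1)) with h2 | h2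
      · exact h2
      · exact absurd h1 (hcon _ _ _ h2)
  have hk : ∀ k : ℕ, O.dir (k : ZMod (2 * n + 1)) (k + 1) ↔ (Even k ↔ O.dir 0 (0 + 1)) := by
    intro k
    induction k with
    | zero => simp
    | succ k ih =>
      push_cast
      rw [hs, ih, Nat.even_add_one]
      tauto
  have := hk (2 * n + 1)
  rw [ZMod.natCast_self] at this
  have ho : ¬ Even (2 * n + 1) := by
    rw [Nat.not_even_iff_odd]; exact ⟨n, rfl⟩
  tauto

/-- rotation -/
def rot {m : ℕ} (O : GraphOrientation (cycleGraphZMod m)) (d : ZMod m) :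
    GraphOrientation (cycleGraphZMod m) where
  dir u v := O.dir (u + d) (v + d)
  dir_adj u v h := by
    have := O.dir_adj _ _ h
    rw [adj_iff] at this ⊢
    simpa using this
  adj_dir u v h := by
    apply O.adj_dir
    rw [adj_iff] at h ⊢
    simpa using h
  asymm u v h := O.asymm _ _ h

lemma rot_trans {m : ℕ} (O : GraphOrientation (cycleGraphZMod m)) (d u v : ZMod m)
    (h : TransGen (rot O d).dir u v) : TransGen O.dir (u + d) (v + d) :=
  TransGen.lift (fun x => x + d) (fun _ _ h => h) _ _ h

lemma rot_num {n : ℕ} (O : GraphOrientation (cycleGraphZMod (2 * n + 1)))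
    (d : ZMod (2 * n + 1)) : O.numLinExt ≤ (rot O d).numLinExt := by
  unfold GraphOrientation.numLinExt
  have : Finite (rot O d).LinExt := by unfold GraphOrientation.LinExt; infer_instance
  refine Nat.card_le_card_of_injective (fun f : O.LinExt =>
    (⟨(Equiv.addRight d).trans f.1, fun u v h => f.2 _ _ (rot_trans O d u v h)⟩ :
      (rot O d).LinExt)) ?_
  intro f g h
  have h := congrArg Subtype.val h
  apply Subtype.ext
  apply Equiv.ext
  intro x
  have := Equiv.congr_fun h (x - d)
  simpa using this

noncomputable def ht (n : ℕ) (c u : ZMod (2 * n + 1)) : ℕ :=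
  if (u - c).val = 0 then 1 else if (u - c).val % 2 = 1 then 0 else 2

lemma ht_succ {n : ℕ} (hn : 1 ≤ n) (c u : ZMod (2 * n + 1)) : ht n c u ≠ ht n c (u + 1) := by
  have hlt := ZMod.val_lt (u - c)
  have hv : (u + 1 - c).val = ((u - c).val + 1) % (2 * n + 1) := by
    rw [show u + 1 - c = (u - c) + 1 by ring, ZMod.val_add, ZMod.val_one'' (by omega)]
  unfold ht
  rw [hv]
  by_cases h : (u - c).val = 2 * n
  · rw [h, Nat.mod_self]; simp; omega
  · rw [Nat.mod_eq_of_lt (show (u - c).val + 1 < 2 * n + 1 by omega)]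
    clear hv
    generalize (u - c).val = x at *
    rcases Nat.eq_zero_or_pos x with rfl | hx
    · simp
    · split_ifs <;> omega

/-- the almost bipartite orientation with its 2-path at `c` -/
noncomputable def ab {n : ℕ} (hn : 1 ≤ n) (c : ZMod (2 * n + 1)) :
    GraphOrientation (cycleGraphZMod (2 * n + 1)) where
  dir u v := (cycleGraphZMod (2 * n + 1)).Adj u v ∧ ht n c u < ht n c v
  dir_adj u v h := h.1
  adj_dir u v h := by
    have : ht n c u ≠ ht n c v := by
      rcases nbr h with rfl | rfl
      · exact (ht_succ hn c v).symm
      · have := ht_succ hn c (v - 1)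
        simpa using this
    rcases lt_or_gt_of_ne this with h' | h'
    · exact Or.inl ⟨h, h'⟩
    · exact Or.inr ⟨h.symm, h'⟩
  asymm u v h h' := by have := h.2; have := h'.2; omega

lemma ab_acyclic {n : ℕ} (hn : 1 ≤ n) (c : ZMod (2 * n + 1)) : (ab hn c).Acyclic := by
  intro v h
  have : ∀ u w, TransGen (ab hn c).dir u w → ht n c u < ht n c w := by
    intro u w h
    induction h with
    | single h => exact h.2
    | tail _ h ih => exact ih.trans h.2
  exact lt_irrefl _ (this v v h)

lemma ab_mid {n : ℕ} (hn : 1 ≤ n) (c : ZMod (2 * n + 1)) (u v w : ZMod (2 * n + 1))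
    (h1 : (ab hn c).dir u v) (h2 : (ab hn c).dir v w) : v = c := by
  have a := h1.2
  have b := h2.2
  unfold ht at a b
  have : (v - c).val = 0 := by
    by_contra h
    simp only [h, if_false] at a b
    split_ifs at a b <;> omega
  rw [ZMod.val_eq_zero] at this
  exact sub_eq_zero.1 this

lemma le_of_mid {n : ℕ} (P Q : GraphOrientation (cycleGraphZMod (2 * n + 1))) (hP : P.Acyclic)
    (hQa : Q.Acyclic) (c u' w' : ZMod (2 * n + 1))
    (hQ : ∀ u v w, Q.dir u v → Q.dir v w → v = c) (h1 : P.dir u' c) (h2 : P.dir c w') :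
    P.numLinExt ≤ Q.numLinExt := by
  rw [numLinExt_eq, numLinExt_eq]
  exact comp_le hP (fun _ _ _ h h' => h.trans h') hQa (comp_of_double P Q c u' w' hQ h1 h2) _ _ rfl

lemma small_ne {n k : ℕ} (h0 : 0 < k) (hk : k < 2 * n + 1) : ((k : ℕ) : ZMod (2 * n + 1)) ≠ 0 := by
  intro h
  rw [ZMod.natCast_eq_zero_iff] at h
  exact absurd (Nat.le_of_dvd h0 h) (by omega)

lemma lt_of_mid {n : ℕ} (hn : 2 ≤ n) (P Q : GraphOrientation (cycleGraphZMod (2 * n + 1)))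
    (hP : P.Acyclic)
    (hQa : Q.Acyclic) (c u' w' v u w : ZMod (2 * n + 1))
    (hQ : ∀ u v w, Q.dir u v → Q.dir v w → v = c) (h1 : P.dir u' c) (h2 : P.dir c w')
    (hvc : v ≠ c) (h3 : P.dir u v) (h4 : P.dir v w) :
    P.numLinExt < Q.numLinExt := by
  rw [numLinExt_eq, numLinExt_eq]
  have e1 : (1 : ZMod (2 * n + 1)) ≠ 0 := by exact_mod_cast small_ne (n := n) (k := 1) (by omega) (by omega)
  have e3 : (3 : ZMod (2 * n + 1)) ≠ 0 := by exact_mod_cast small_ne (n := n) (k := 3) (by omega) (by omega)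
  have e4 : (4 : ZMod (2 * n + 1)) ≠ 0 := by exact_mod_cast small_ne (n := n) (k := 4) (by omega) (by omega)
  have nu := nbr (P.dir_adj _ _ h3)
  have nw := nbr (P.dir_adj _ _ h4).symm
  have huw : u ≠ w := by rintro rfl; exact P.asymm _ _ h3 h4
  have cases : (u = v + 1 ∧ w = v - 1) ∨ (u = v - 1 ∧ w = v + 1) := by
    rcases nu with rfl | rfl <;> rcases nw with rfl | rfl <;> simp_all
  have nadj : ∀ x : ZMod (2 * n + 1), ¬ (cycleGraphZMod (2 * n + 1)).Adj (x + 1) (x - 1) := by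
    intro x h
    rcases (adj_iff _ _).1 h with ⟨_, h | h⟩
    · exact e1 (by linear_combination h)
    · exact e3 (by linear_combination -h)
  have nmid : ∀ a b, TransGen Q.dir a b → ¬ ((a = v + 1 ∧ b = v - 1) ∨ (a = v - 1 ∧ b = v + 1)) := by
    intro a b hab hh
    rcases trans_mid Q c hQ a b hab with h | ⟨ha, hb⟩
    · have h := Q.dir_adj _ _ h
      rcases hh with ⟨rfl, rfl⟩ | ⟨rfl, rfl⟩
      · exact nadj _ h
      · exact nadj _ h.symm
    · have na := nbr (Q.dir_adj _ _ ha)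
      have nb := nbr (Q.dir_adj _ _ hb).symm
      have hne : a ≠ b := by rintro rfl; exact Q.asymm _ _ ha hb
      rcases hh with ⟨h5, h6⟩ | ⟨h5, h6⟩
      · rcases na with h7 | h7
        · exact hvc (by linear_combination h7 - h5)
        · rcases nb with h8 | h8
          · exact e4 (by linear_combination h6 - h5 + h7 - h8)
          · exact hne (h7.trans h8.symm)
      · rcases na with h7 | h7
        · rcases nb with h8 | h8
          · exact hne (h7.trans h8.symm)
          · exact e4 (by linear_combination h5 - h6 - h7 + h8)
        · exact hvc (by linear_combination h7 - h5)
  refine comp_lt hP (fun _ _ _ h h' => h.trans h') hQa (comp_of_double P Q c u' w' hQ h1 h2)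
    u w (.tail (.single h3) h4) (fun h => nmid _ _ h cases) (fun h => nmid _ _ h (by tauto)) _ _ rfl
    (Finset.mem_univ _) (Finset.mem_univ _)

lemma three (O : GraphOrientation (cycleGraphZMod 3)) (hO : O.Acyclic) (u c w u' v w' : ZMod 3)
    (h1 : O.dir u c) (h2 : O.dir c w) (h3 : O.dir u' v) (h4 : O.dir v w') : v = c := by
  by_contra hne
  have ir : ∀ x, ¬ O.dir x x := fun x h => O.asymm _ _ h h
  have d1 : u ≠ c := by rintro rfl; exact ir _ h1
  have d2 : c ≠ w := by rintro rfl; exact ir _ h2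
  have d3 : u ≠ w := by rintro rfl; exact O.asymm _ _ h1 h2
  have d4 : u' ≠ v := by rintro rfl; exact ir _ h3
  have d5 : v ≠ w' := by rintro rfl; exact ir _ h4
  have d6 : u' ≠ w' := by rintro rfl; exact O.asymm _ _ h3 h4
  have all : ∀ u c w x : ZMod 3, u ≠ c → c ≠ w → u ≠ w → x = u ∨ x = c ∨ x = w := by decide
  have no : ∀ x y z, O.dir x y → O.dir y z → O.dir z x → False := fun x y z a b d =>
    hO x (.tail (.tail (.single a) b) d)
  have as := O.asymm
  rcases all u c w v d1 d2 d3 with rfl | rfl | rfl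
  · rcases all v c w u' d1 d2 d3 with rfl | rfl | rfl
    · exact d4 rfl
    · exact as _ _ h1 h3
    · exact no _ _ _ h1 h2 h3
  · exact hne rfl
  · rcases all u c v w' d1 d2 d3 with rfl | rfl | rfl
    · exact no _ _ _ h1 h2 h4
    · exact as _ _ h2 h4
    · exact d5 rfl

end LEx

theorem stmt_2 (n : ℕ) (hn : 1 ≤ n) (O : GraphOrientation (cycleGraphZMod (2 * n + 1)))
    (hO : O.Acyclic) :
    (∀ O' : GraphOrientation (cycleGraphZMod (2 * n + 1)), O'.Acyclic →
        O'.numLinExt ≤ O.numLinExt) ↔ O.AlmostBipartite := by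
  constructor
  · intro hmax
    obtain ⟨u, c, w, h1, h2⟩ := LEx.exists_double hn O
    have hmid : ∀ u' v w', O.dir u' v → O.dir v w' → v = c := by
      intro u' v w' h3 h4
      by_cases hn1 : n = 1
      · subst hn1
        exact LEx.three O hO u c w u' v w' h1 h2 h3 h4
      · by_contra hne
        have := LEx.lt_of_mid (by omega) O (LEx.ab hn c) hO (LEx.ab_acyclic hn c) c u w v u' w'
          (LEx.ab_mid hn c) h1 h2 hne h3 h4
        have := hmax _ (LEx.ab_acyclic hn c)
        omega
    refine ⟨(u, c, w), ⟨h1, h2⟩, ?_⟩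
    rintro ⟨u', v, w'⟩ ⟨h3, h4⟩
    dsimp only at h3 h4
    have := hmid _ _ _ h3 h4
    subst this
    have a1 := LEx.nbr (O.dir_adj _ _ h1)
    have a2 := LEx.nbr (O.dir_adj _ _ h2).symm
    have a3 := LEx.nbr (O.dir_adj _ _ h3)
    have a4 := LEx.nbr (O.dir_adj _ _ h4).symm
    have b1 : u ≠ w := by rintro rfl; exact O.asymm _ _ h1 h2
    have b2 : u' ≠ w' := by rintro rfl; exact O.asymm _ _ h3 h4
    have b3 : u ≠ w' := by rintro rfl; exact O.asymm _ _ h1 h4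
    have b4 : u' ≠ w := by rintro rfl; exact O.asymm _ _ h3 h2
    rcases a1 with rfl | rfl <;> rcases a2 with rfl | rfl <;> rcases a3 with rfl | rfl <;>
      rcases a4 with rfl | rfl <;>
      first
      | rfl
      | exact absurd rfl b1
      | exact absurd rfl b2
      | exact absurd rfl b3
      | exact absurd rfl b4
  · rintro ⟨⟨u, c, w⟩, -, huniq⟩ O' hO'
    have hmid : ∀ u' v w', O.dir u' v → O.dir v w' → v = c := by
      intro u' v w' h3 h4
      have := huniq (u', v, w') ⟨h3, h4⟩
      exact congrArg (fun t => t.2.1) this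
    obtain ⟨u', c', w', h1, h2⟩ := LEx.exists_double hn O'
    refine (LEx.rot_num O' (c' - c)).trans
      (LEx.le_of_mid (LEx.rot O' (c' - c)) O ?_ hO c (u' - (c' - c)) (w' - (c' - c)) hmid ?_ ?_)
    · intro v h
      exact hO' _ (LEx.rot_trans O' _ _ _ h)
    · simpa [LEx.rot] using h1
    · simpa [LEx.rot] using h2
end

section
/- Let G be a simple graph on [n] and P a poset induced by some acyclic orientation of G. Then the chain polytope C(P) is contained in the stable polytope STAB(G), and hence ε(G) ≤ n!·Vol(STAB(G)). -/
open MeasureTheory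

/-- The maximal number of linear extensions of a poset induced by an acyclic
orientation of `G`, denoted `ε(G)` in the paper. -/
noncomputable def maxLinExt {V : Type*} [Fintype V] (G : SimpleGraph V) : ℕ :=
  sSup {k | ∃ O : GraphOrientation G, O.Acyclic ∧ k = O.numLinExt}

/-- The chain polytope of the partial order whose order relation is `le`. -/
def chainPolytopeOf {V : Type*} [Fintype V] (le : V → V → Prop) : Set (V → ℝ) :=
  {x | (∀ i, 0 ≤ x i) ∧ ∀ C : Finset V, IsChain le ↑C → ∑ i ∈ C, x i ≤ 1}

/-- The stable polytope of `G`: the convex hull of indicator vectors of stable sets. -/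
noncomputable def stablePolytope {V : Type*} [Fintype V] [DecidableEq V]
    (G : SimpleGraph V) : Set (V → ℝ) :=
  convexHull ℝ {x | ∃ S : Finset V, (∀ u ∈ S, ∀ v ∈ S, ¬ G.Adj u v) ∧
    x = fun i => if i ∈ S then (1 : ℝ) else 0}

lemma auxStab {V : Type*} [Fintype V] [DecidableEq V] (G : SimpleGraph V)
    (O : GraphOrientation G) (x h : V → ℝ) (hx : ∀ v, 0 ≤ x v) (h1 : ∀ v, h v ≤ 1)
    (h0 : ∀ v, 0 ≤ h v - x v) (hd : ∀ u v, O.dir u v → h u ≤ h v - x v) :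
    x ∈ stablePolytope G := by
  classical
  have hfin : {x : V → ℝ | ∃ S : Finset V, (∀ u ∈ S, ∀ v ∈ S, ¬ G.Adj u v) ∧
    x = fun i => if i ∈ S then (1 : ℝ) else 0}.Finite := by
    refine (Set.finite_range (fun S : Finset V => fun i => if i ∈ S then (1 : ℝ) else 0)).subset ?_
    rintro y ⟨S, -, rfl⟩
    exact ⟨S, rfl⟩
  have hcl := hfin.isClosed_convexHull ℝ
  have hprob : IsProbabilityMeasure ((volume : Measure ℝ).restrict (Set.Ico 0 1)) :=
    ⟨by simp⟩
  let F : ℝ → V → ℝ := fun t v => (Set.Ico (h v - x v) (h v)).indicator (fun _ => (1 : ℝ)) t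
  have hint : ∀ v, Integrable (F · v) ((volume : Measure ℝ).restrict (Set.Ico 0 1)) := by
    intro v
    exact (integrable_const (1 : ℝ)).indicator measurableSet_Ico
  have hmem := Convex.integral_mem (μ := (volume : Measure ℝ).restrict (Set.Ico 0 1)) (f := F)
    (convex_convexHull ℝ _) hcl ?_ (Integrable.of_eval hint)
  · have : ∫ t in Set.Ico 0 1, F t = x := by
      ext v
      rw [eval_integral hint]
      simp only [F]
      rw [setIntegral_indicator measurableSet_Ico,
        Set.inter_eq_right.2 (Set.Ico_subset_Ico (h0 v) (h1 v))]
      simp [hx v]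
    rw [this] at hmem
    exact hmem
  · refine Filter.Eventually.of_forall fun t => subset_convexHull ℝ _ ?_
    refine ⟨Finset.univ.filter fun v => t ∈ Set.Ico (h v - x v) (h v), ?_, ?_⟩
    · intro u hu v hv huv
      simp only [Finset.mem_filter, Finset.mem_univ, true_and, Set.mem_Ico] at hu hv
      rcases O.adj_dir u v huv with e | e
      · linarith [hd _ _ e]
      · linarith [hd _ _ e]
    · ext v
      simp [F, Set.indicator_apply]

lemma auxChain {V : Type*} [Fintype V] [DecidableEq V] (G : SimpleGraph V)
    (O : GraphOrientation G) (hO : O.Acyclic) :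
    chainPolytopeOf (Relation.ReflTransGen O.dir) ⊆ stablePolytope G := by
  classical
  rintro x ⟨hx, hC⟩
  let A : V → Finset (Finset V) := fun v => Finset.univ.filter fun C =>
    IsChain (Relation.ReflTransGen O.dir) (C : Set V) ∧ v ∈ C ∧
      ∀ u ∈ C, Relation.ReflTransGen O.dir u v
  have hs : ∀ v, {v} ∈ A v := by
    intro v
    simp [A, Relation.ReflTransGen.refl]
  have hA : ∀ v, (A v).Nonempty := fun v => ⟨_, hs v⟩
  let h : V → ℝ := fun v => (A v).sup' (hA v) fun C => ∑ i ∈ C, x i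
  have hle : ∀ v, ∀ C ∈ A v, ∑ i ∈ C, x i ≤ h v := fun v C hC' =>
    Finset.le_sup' (fun C => ∑ i ∈ C, x i) hC'
  refine auxStab G O x h hx ?_ ?_ ?_
  · intro v
    refine Finset.sup'_le _ _ fun C hC' => hC C ?_
    exact (Finset.mem_filter.1 hC').2.1
  · intro v
    have := hle v _ (hs v)
    simp at this
    linarith
  · intro u v huv
    obtain ⟨C, hCm, hCe⟩ := Finset.exists_mem_eq_sup' (hA u) fun C => ∑ i ∈ C, x i
    obtain ⟨-, c1, c2, c3⟩ := Finset.mem_filter.1 hCm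
    have hv : v ∉ C := fun hv => hO u (Relation.TransGen.head' huv (c3 v hv))
    have := hle v (insert v C) (by
      refine Finset.mem_filter.2 ⟨Finset.mem_univ _, ?_, Finset.mem_insert_self _ _, ?_⟩
      · rw [Finset.coe_insert]
        exact c1.insert fun b hb _ => Or.inr ((c3 b hb).tail huv)
      · intro w hw
        rcases Finset.mem_insert.1 hw with rfl | hw
        · exact .refl
        · exact (c3 w hw).tail huv)
    rw [Finset.sum_insert hv] at this
    change h u = _ at hCe
    linarith

/-- open simplex associated with an ordering. -/
def auxSimplex {V : Type*} [Fintype V] (f : V ≃ Fin (Fintype.card V)) : Set (V → ℝ) :=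
  {y | (∀ v, 0 < y v ∧ y v < 1) ∧ ∀ u v, f u < f v → y u < y v}

lemma auxSimplex_meas {V : Type*} [Fintype V] (f : V ≃ Fin (Fintype.card V)) :
    MeasurableSet (auxSimplex f) := by
  unfold auxSimplex
  measurability

lemma auxSimplex_vol_eq {V : Type*} [Fintype V] (f g : V ≃ Fin (Fintype.card V)) :
    volume (auxSimplex f) = volume (auxSimplex g) := by
  have mp := volume_measurePreserving_piCongrLeft (fun _ : V => ℝ) (f.trans g.symm)
  rw [← mp.measure_preimage (auxSimplex_meas g).nullMeasurableSet]
  congr 1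
  have key : ∀ (y : V → ℝ) (v : V),
      MeasurableEquiv.piCongrLeft (fun _ : V => ℝ) (f.trans g.symm) y ((f.trans g.symm) v)
        = y v := by
    intro y v
    rw [MeasurableEquiv.coe_piCongrLeft]
    exact Equiv.piCongrLeft_apply_apply (P := fun _ : V => ℝ) (f.trans g.symm) y v
  have key2 : ∀ (y : V → ℝ) (v : V),
      MeasurableEquiv.piCongrLeft (fun _ : V => ℝ) (f.trans g.symm) y v
        = y (f.symm (g v)) := by
    intro y v
    rw [← key y (f.symm (g v))]
    simp
  ext y
  constructor
  · rintro ⟨h1, h2⟩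
    refine ⟨fun v => ?_, fun u v huv => ?_⟩
    · rw [key2]; exact h1 _
    · rw [key2, key2]; exact h2 _ _ (by simpa using huv)
  · rintro ⟨h1, h2⟩
    refine ⟨fun v => ?_, fun u v huv => ?_⟩
    · rw [← key y v]; exact h1 _
    · rw [← key y v, ← key y u]; exact h2 _ _ (by simpa using huv)

lemma auxSimplex_disj {V : Type*} [Fintype V] (f g : V ≃ Fin (Fintype.card V)) (y : V → ℝ)
    (hf : y ∈ auxSimplex f) (hg : y ∈ auxSimplex g) : f = g := by
  have hm : StrictMono (f.symm.trans g) := by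
    intro a b hab
    by_contra hc
    have h1 : y (f.symm a) < y (f.symm b) := hf.2 _ _ (by simpa using hab)
    rcases lt_or_eq_of_le (not_lt.1 hc) with h | h
    · exact absurd (hg.2 _ _ h) (not_lt.2 h1.le)
    · have := (f.symm.trans g).injective h
      omega
  have : (f.symm.trans g : Fin (Fintype.card V) → Fin (Fintype.card V)) = id := by
    have := Subsingleton.elim (hm.orderIsoOfSurjective _ (f.symm.trans g).surjective)
      (OrderIso.refl _)
    ext a
    have := congrArg (fun e : _ ≃o _ => e a) this
    simpa using congrArg Fin.val this
  ext v
  have := congrFun this (f v)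
  simp at this
  rw [this]

lemma auxSimplex_vol {V : Type*} [Fintype V] (f : V ≃ Fin (Fintype.card V)) :
    1 ≤ ((Fintype.card V).factorial : ENNReal) * volume (auxSimplex f) := by
  classical
  have hnull : ∀ p : V × V, p.1 ≠ p.2 → volume {y : V → ℝ | y p.1 = y p.2} = 0 := by
    rintro ⟨i, j⟩ hij
    let L : (V → ℝ) →ₗ[ℝ] ℝ :=
      LinearMap.proj (R := ℝ) (φ := fun _ : V => ℝ) i - LinearMap.proj (R := ℝ) (φ := fun _ : V => ℝ) j
    have h1 : {y : V → ℝ | y i = y j} = (LinearMap.ker L : Set (V → ℝ)) := by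
      ext y
      simp [L, sub_eq_zero]
    rw [h1]
    refine Measure.addHaar_submodule _ _ fun ht => ?_
    have : Pi.single i (1 : ℝ) ∈ LinearMap.ker L := ht ▸ Submodule.mem_top
    have hij' : j ≠ i := Ne.symm hij
    simp [L, hij'] at this
  let B : Set (V → ℝ) := ⋃ p : {p : V × V // p.1 ≠ p.2}, {y : V → ℝ | y p.1.1 = y p.1.2}
  have hB : volume B = 0 := measure_iUnion_null fun p => hnull p.1 p.2
  have hcov : (Set.univ.pi fun _ : V => Set.Ioo (0 : ℝ) 1) ⊆
      (⋃ g : V ≃ Fin (Fintype.card V), auxSimplex g) ∪ B := by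
    intro y hy
    by_cases hinj : Function.Injective y
    · left
      letI : LinearOrder V := LinearOrder.lift' y hinj
      let e := Fintype.orderIsoFinOfCardEq V rfl
      refine Set.mem_iUnion.2 ⟨e.symm.toEquiv, fun v => hy v trivial, fun u v huv => ?_⟩
      exact e.symm.lt_iff_lt.1 huv
    · right
      simp only [Function.Injective, not_forall] at hinj
      obtain ⟨a, b, h1, h2⟩ := hinj
      exact Set.mem_iUnion.2 ⟨⟨(a, b), h2⟩, h1⟩
  calc (1 : ENNReal) = volume (Set.univ.pi fun _ : V => Set.Ioo (0 : ℝ) 1) := by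
        rw [volume_pi_pi]; simp
    _ ≤ volume ((⋃ g : V ≃ Fin (Fintype.card V), auxSimplex g) ∪ B) := measure_mono hcov
    _ ≤ volume (⋃ g : V ≃ Fin (Fintype.card V), auxSimplex g) + volume B := measure_union_le _ _
    _ ≤ ∑ g : V ≃ Fin (Fintype.card V), volume (auxSimplex g) := by
        rw [hB, add_zero]
        exact measure_iUnion_fintype_le _ _
    _ = _ := by
        rw [Finset.sum_congr rfl fun g _ => auxSimplex_vol_eq g f, Finset.sum_const,
          Finset.card_univ, Fintype.card_equiv f, nsmul_eq_mul]

open Classical in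
/-- largest value on predecessors (or zero). -/
noncomputable def auxM {V : Type*} [Fintype V] {G : SimpleGraph V} (O : GraphOrientation G)
    (y : V → ℝ) (v : V) : ℝ :=
  (Finset.univ.filter fun u => O.dir u v).fold max 0 y

/-- Stanley's transfer map. -/
noncomputable def auxT {V : Type*} [Fintype V] {G : SimpleGraph V} (O : GraphOrientation G)
    (y : V → ℝ) (v : V) : ℝ := y v - auxM O y v

lemma auxT_inj {V : Type*} [Fintype V] {G : SimpleGraph V} (O : GraphOrientation G)
    (hO : O.Acyclic) : Function.Injective (auxT O) := by
  classical
  intro y z hyz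
  haveI : Std.Irrefl (Relation.TransGen O.dir) := ⟨hO⟩
  have wf : WellFounded (Relation.TransGen O.dir) := Finite.wellFounded_of_trans_of_irrefl _
  ext v
  induction v using wf.induction with
  | _ v ih =>
    have h1 := congrFun hyz v
    have h2 : auxM O y v = auxM O z v := by
      unfold auxM
      refine Finset.fold_congr fun u hu => ih u (.single (Finset.mem_filter.1 hu).2)
    simp only [auxT, h2] at h1
    linarith

lemma auxT_lin {V : Type*} [Fintype V] {G : SimpleGraph V} (O : GraphOrientation G)
    (f : V ≃ Fin (Fintype.card V)) (hf : ∀ u v, O.dir u v → f u < f v) :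
    ∃ L : (V → ℝ) →ₗ[ℝ] (V → ℝ), LinearMap.det L = 1 ∧ ∀ y ∈ auxSimplex f, auxT O y = L y := by
  classical
  have hp : ∀ v, ∃ p : Option V, (∀ u, p = some u → O.dir u v) ∧
      ∀ y ∈ auxSimplex f, auxM O y v = p.elim 0 y := by
    intro v
    by_cases hne : (Finset.univ.filter fun u => O.dir u v).Nonempty
    · obtain ⟨u, hu, hmax⟩ := Finset.exists_max_image _ f hne
      refine ⟨some u, ?_, ?_⟩
      · rintro w ⟨⟩
        exact (Finset.mem_filter.1 hu).2
      · intro y hy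
        unfold auxM
        refine le_antisymm ?_ ?_
        · refine Finset.fold_max_le _ |>.2 ⟨(hy.1 u).1.le, fun w hw => ?_⟩
          rcases lt_or_eq_of_le (hmax w hw) with h | h
          · exact (hy.2 _ _ h).le
          · rw [f.injective h]; rfl
        · refine Finset.le_fold_max _ |>.2 (Or.inr ⟨u, hu, le_rfl⟩)
    · refine ⟨none, by simp, fun y hy => ?_⟩
      rw [Finset.not_nonempty_iff_eq_empty] at hne
      unfold auxM
      rw [hne]
      rfl
  choose p hp1 hp2 using hp
  let A : Matrix V V ℝ :=
    Matrix.of fun v w => (if v = w then 1 else 0) - (if p v = some w then 1 else 0)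
  refine ⟨Matrix.toLin' A, ?_, ?_⟩
  · rw [LinearMap.det_toLin', ← Matrix.det_submatrix_equiv_self f.symm A]
    rw [Matrix.det_of_isLowerTriangular]
    · refine Finset.prod_eq_one fun i _ => ?_
      have : p (f.symm i) ≠ some (f.symm i) := fun h =>
        lt_irrefl _ (hf _ _ (hp1 _ _ h))
      simp [A, this]
    · intro i j hij
      have hij : i < j := hij
      have : p (f.symm i) ≠ some (f.symm j) := fun h => by
        have := hf _ _ (hp1 _ _ h)
        simp at this
        exact absurd hij (not_lt.2 this.le)
      simp [A, this, hij.ne]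
  · intro y hy
    ext v
    rw [auxT, hp2 v y hy]
    simp only [Matrix.toLin'_apply, Matrix.mulVec, dotProduct, A, Matrix.of_apply, sub_mul, Finset.sum_sub_distrib]
    rcases h : p v with _ | u <;> simp

lemma auxNum {V : Type*} [Fintype V] [DecidableEq V] (G : SimpleGraph V)
    (O : GraphOrientation G) (hO : O.Acyclic) :
    (O.numLinExt : ENNReal) ≤
      ((Fintype.card V).factorial : ENNReal) * volume (stablePolytope G) := by
  classical
  haveI : Finite O.LinExt := by unfold GraphOrientation.LinExt; infer_instance
  letI : Fintype O.LinExt := Fintype.ofFinite _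
  have hL := fun f : O.LinExt => auxT_lin O f.1 fun u v h => f.2 u v (.single h)
  have himg : ∀ f : O.LinExt, volume (auxT O '' auxSimplex f.1) = volume (auxSimplex f.1) ∧
      MeasurableSet (auxT O '' auxSimplex f.1) := by
    intro f
    obtain ⟨L, hdet, hL⟩ := hL f
    have e : auxT O '' auxSimplex f.1 = L '' auxSimplex f.1 := Set.image_congr hL
    constructor
    · rw [e, Measure.addHaar_image_linearMap, hdet]
      simp
    · rw [e]
      refine (auxSimplex_meas f.1).image_of_continuousOn_injOn
        (LinearMap.continuous_of_finiteDimensional L).continuousOn ?_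
      intro a ha b hb hab
      rw [← hL a ha, ← hL b hb] at hab
      exact auxT_inj O hO hab
  have hsub : (⋃ f : O.LinExt, auxT O '' auxSimplex f.1) ⊆ stablePolytope G := by
    refine Set.iUnion_subset fun f => ?_
    rintro _ ⟨y, hy, rfl⟩
    have hM0 : ∀ v, 0 ≤ auxM O y v := fun v => (Finset.le_fold_max _).2 (Or.inl le_rfl)
    refine auxStab G O _ y ?_ (fun v => (hy.1 v).2.le) ?_ ?_
    · intro v
      refine sub_nonneg.2 ((Finset.fold_max_le _).2 ⟨(hy.1 v).1.le, fun u hu => ?_⟩)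
      exact (hy.2 _ _ (f.2 _ _ (.single (Finset.mem_filter.1 hu).2))).le
    · intro v
      simp [auxT, hM0]
    · intro u v huv
      simp only [auxT, sub_sub_cancel]
      exact (Finset.le_fold_max _).2 (Or.inr ⟨u, by simp [huv], le_rfl⟩)
  have hdisj : Pairwise (Function.onFun Disjoint fun f : O.LinExt => auxT O '' auxSimplex f.1) := by
    intro f g hfg
    refine Set.disjoint_left.2 ?_
    rintro _ ⟨y, hy, rfl⟩ ⟨z, hz, hzy⟩
    rw [auxT_inj O hO hzy] at hz
    exact hfg (Subtype.ext (auxSimplex_disj _ _ y hy hz))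
  calc (O.numLinExt : ENNReal) = ∑ f : O.LinExt, 1 := by
        simp [GraphOrientation.numLinExt]
    _ ≤ ∑ f : O.LinExt, ((Fintype.card V).factorial : ENNReal) * volume (auxSimplex f.1) :=
        Finset.sum_le_sum fun f _ => auxSimplex_vol f.1
    _ = ((Fintype.card V).factorial : ENNReal) *
          volume (⋃ f : O.LinExt, auxT O '' auxSimplex f.1) := by
        rw [measure_iUnion hdisj fun f => (himg f).2, tsum_fintype, Finset.mul_sum]
        exact Finset.sum_congr rfl fun f _ => by rw [(himg f).1]
    _ ≤ _ := by gcongr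

theorem stmt_13 (n : ℕ) (G : SimpleGraph (Fin n)) (O : GraphOrientation G)
    (hO : O.Acyclic) :
    chainPolytopeOf (Relation.ReflTransGen O.dir) ⊆ stablePolytope G ∧
    (maxLinExt G : ENNReal) ≤ (Nat.factorial n : ENNReal) * volume (stablePolytope G) := by
  refine ⟨auxChain G O hO, ?_⟩
  have hne : {k | ∃ O : GraphOrientation G, O.Acyclic ∧ k = O.numLinExt}.Nonempty :=
    ⟨_, O, hO, rfl⟩
  have hbdd : BddAbove {k | ∃ O : GraphOrientation G, O.Acyclic ∧ k = O.numLinExt} := by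
    refine ⟨Nat.card (Fin n ≃ Fin (Fintype.card (Fin n))), ?_⟩
    rintro _ ⟨O', -, rfl⟩
    exact Nat.card_le_card_of_injective (fun f : O'.LinExt => f.1) Subtype.val_injective
  obtain ⟨O', hO', h⟩ := Nat.sSup_mem hne hbdd
  have := auxNum G O' hO'
  rw [← h, Fintype.card_fin] at this
  exact this
end

section
/- Let G = ([n],E) be a simple graph and A_G its graphical arrangement. If R is a region of A_G and P the poset on [n] corresponding to R (via the acyclic orientation determined by R), then the fractional volume of R equals e(P)/n!, where the fractional volume is Vol(Bⁿ ∩ R)/Vol(Bⁿ) with Bⁿ the unit ball. -/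
open MeasureTheory

/-- The open braid-arrangement chamber of a labeling. -/
def braidCell {n m : ℕ} (f : Fin n ≃ Fin m) : Set (EuclideanSpace ℝ (Fin n)) :=
  {x | ∀ i j, f i < f j → x i < x j}

lemma braidCell_meas {n m : ℕ} (f : Fin n ≃ Fin m) : MeasurableSet (braidCell f) := by
  unfold braidCell
  simp only [Set.ofPred_forall]
  refine MeasurableSet.iInter fun i => MeasurableSet.iInter fun j => MeasurableSet.iInter fun _ => ?_
  exact measurableSet_lt (by fun_prop) (by fun_prop)

lemma braidCell_lt_iff {n m : ℕ} (f : Fin n ≃ Fin m) {x : EuclideanSpace ℝ (Fin n)}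
    (hx : x ∈ braidCell f) (i j : Fin n) : f i < f j ↔ x i < x j := by
  refine ⟨hx i j, fun h => ?_⟩
  by_contra hc
  rcases (not_lt.mp hc).lt_or_eq with h1 | h1
  · exact absurd (hx _ _ h1) (not_lt.mpr h.le)
  · have := f.injective h1
    subst this
    exact lt_irrefl _ h

lemma braidCell_disj {n m : ℕ} (f g : Fin n ≃ Fin m) (hfg : f ≠ g) :
    Disjoint (braidCell f) (braidCell g) := by
  rw [Set.disjoint_left]
  intro x hf hg
  apply hfg
  have hm : StrictMono (f.symm.trans g) := by
    intro a b hab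
    have := (braidCell_lt_iff f hf (f.symm a) (f.symm b)).1 (by simpa using hab)
    exact (braidCell_lt_iff g hg _ _).2 this
  have h1 : (hm.orderIsoOfSurjective _ (f.symm.trans g).surjective) = OrderIso.refl _ :=
    Subsingleton.elim _ _
  ext i
  have h2 := congrArg (fun e : Fin m ≃o Fin m => e (f i)) h1
  simp at h2
  rw [h2]

lemma braidCell_cover {n : ℕ} (x : EuclideanSpace ℝ (Fin n))
    (hx : Function.Injective (fun i => x i)) :
    ∃ f : Fin n ≃ Fin (Fintype.card (Fin n)), x ∈ braidCell f := by
  let s := Tuple.sort (fun i => x i)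
  have hm : StrictMono ((fun i => x i) ∘ s) :=
    (Tuple.monotone_sort (fun i => x i)).strictMono_of_injective (hx.comp s.injective)
  refine ⟨s.symm.trans (finCongr (Fintype.card_fin n).symm), fun i j h => ?_⟩
  have h' : s.symm i < s.symm j := h
  simpa using hm h'

lemma ae_inj (n : ℕ) : ∀ᵐ x : EuclideanSpace ℝ (Fin n), Function.Injective (fun i => x i) := by
  have key : ∀ i j : Fin n, i ≠ j → ∀ᵐ x : EuclideanSpace ℝ (Fin n), x i ≠ x j := by
    intro i j hij
    let L : EuclideanSpace ℝ (Fin n) →ₗ[ℝ] ℝ :=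
      { toFun := fun x => x i - x j
        map_add' := by intro x y; simp; ring
        map_smul' := by intro c x; simp; ring }
    have h := Measure.addHaar_submodule (volume : Measure (EuclideanSpace ℝ (Fin n)))
      (LinearMap.ker L) (by
        intro h
        have h1 : EuclideanSpace.single i (1:ℝ) ∈ LinearMap.ker L := by rw [h]; trivial
        have h2 : L (EuclideanSpace.single i (1:ℝ)) = 0 := h1
        simp [L, hij.symm] at h2)
    rw [ae_iff]
    convert h using 2
    ext x
    simp [L, sub_eq_zero]
  have h2 : ∀ᵐ x : EuclideanSpace ℝ (Fin n), ∀ i j : Fin n, i ≠ j → x i ≠ x j := by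
    rw [ae_all_iff]; intro i
    rw [ae_all_iff]; intro j
    by_cases h : i = j
    · simp [h]
    · filter_upwards [key i j h] with x hx _ using hx
  filter_upwards [h2] with x hx i j hij
  by_contra hc
  exact hx i j hc hij

lemma vol_decomp {n : ℕ} (S : Set (EuclideanSpace ℝ (Fin n))) (hS : MeasurableSet S) :
    volume S = ∑ f : Fin n ≃ Fin (Fintype.card (Fin n)), volume (S ∩ braidCell f) := by
  have h1 : volume S = volume (⋃ f : Fin n ≃ Fin (Fintype.card (Fin n)), S ∩ braidCell f) := by
    apply measure_congr
    filter_upwards [ae_inj n] with x hx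
    obtain ⟨f, hf⟩ := braidCell_cover x hx
    apply propext
    change x ∈ S ↔ x ∈ (⋃ f : Fin n ≃ Fin (Fintype.card (Fin n)), S ∩ braidCell f)
    simp only [Set.mem_iUnion, Set.mem_inter_iff]
    exact ⟨fun h => ⟨f, h, hf⟩, fun ⟨_, h, _⟩ => h⟩
  rw [h1, measure_iUnion, tsum_fintype]
  · intro f g hfg
    exact (braidCell_disj f g hfg).mono Set.inter_subset_right Set.inter_subset_right
  · exact fun f => hS.inter (braidCell_meas f)

lemma vol_cell_eq {n m : ℕ} (f g : Fin n ≃ Fin m) :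
    volume (Metric.ball (0 : EuclideanSpace ℝ (Fin n)) 1 ∩ braidCell f) =
    volume (Metric.ball (0 : EuclideanSpace ℝ (Fin n)) 1 ∩ braidCell g) := by
  let e := g.trans f.symm
  let T := LinearIsometryEquiv.piLpCongrLeft 2 ℝ ℝ e
  have hT := T.measurePreserving
  rw [← hT.measure_preimage
    (Metric.isOpen_ball.measurableSet.inter (braidCell_meas f)).nullMeasurableSet]
  congr 1
  ext x
  simp only [Set.mem_preimage, Set.mem_inter_iff, mem_ball_zero_iff, LinearIsometryEquiv.norm_map]
  refine and_congr_right fun _ => ?_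
  have hv : ∀ i, T x i = x (e.symm i) := fun i => by
    simp [T, LinearIsometryEquiv.piLpCongrLeft_apply, Equiv.piCongrLeft']
  constructor
  · intro h i j hij
    have := h (e i) (e j) (by simpa [e] using hij)
    simpa [hv] using this
  · intro h i j hij
    rw [hv, hv]
    exact h _ _ (by simpa [e] using hij)

theorem stmt_17 (n : ℕ) (G : SimpleGraph (Fin n)) (O : GraphOrientation G)
    (hO : O.Acyclic) :
    volume (Metric.ball (0 : EuclideanSpace ℝ (Fin n)) 1 ∩
        {x : EuclideanSpace ℝ (Fin n) | ∀ u v, O.dir u v → x u < x v}) =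
      volume (Metric.ball (0 : EuclideanSpace ℝ (Fin n)) 1) * (O.numLinExt : ENNReal) /
        (Nat.factorial n : ENNReal) := by
  classical
  set B := Metric.ball (0 : EuclideanSpace ℝ (Fin n)) 1 with hB
  set R := {x : EuclideanSpace ℝ (Fin n) | ∀ u v, O.dir u v → x u < x v} with hR
  have hBm : MeasurableSet B := Metric.isOpen_ball.measurableSet
  have hRm : MeasurableSet R := by
    rw [hR]
    simp only [Set.ofPred_forall]
    refine MeasurableSet.iInter fun i => MeasurableSet.iInter fun j =>
      MeasurableSet.iInter fun _ => ?_
    exact measurableSet_lt (by fun_prop) (by fun_prop)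
  let f0 : Fin n ≃ Fin (Fintype.card (Fin n)) := finCongr (Fintype.card_fin n).symm
  set c := volume (B ∩ braidCell f0) with hc
  have h1 : volume B = (n.factorial : ENNReal) * c := by
    rw [vol_decomp B hBm, Finset.sum_congr rfl fun f _ => vol_cell_eq f f0, Finset.sum_const,
      Finset.card_univ, Fintype.card_equiv f0, nsmul_eq_mul]
    congr 3
    exact Fintype.card_fin n
  have h2 : volume (B ∩ R) = (O.numLinExt : ENNReal) * c := by
    rw [vol_decomp _ (hBm.inter hRm)]
    have : ∀ f : Fin n ≃ Fin (Fintype.card (Fin n)), volume (B ∩ R ∩ braidCell f) =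
        if (∀ u v, Relation.TransGen O.dir u v → f u < f v) then c else 0 := by
      intro f
      split_ifs with h
      · rw [hc, ← vol_cell_eq f f0]
        congr 1
        ext x
        simp only [Set.mem_inter_iff]
        exact ⟨fun ⟨⟨a, _⟩, b⟩ => ⟨a, b⟩,
          fun ⟨a, b⟩ => ⟨⟨a, fun u v huv => b u v (h u v (.single huv))⟩, b⟩⟩
      · convert measure_empty (μ := (volume : Measure (EuclideanSpace ℝ (Fin n))))
        rw [Set.eq_empty_iff_forall_notMem]
        rintro x ⟨⟨_, hx⟩, hf⟩
        apply h
        intro u v huv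
        rw [braidCell_lt_iff f hf]
        induction huv with
        | single h => exact hx _ _ h
        | tail _ h ih => exact ih.trans (hx _ _ h)
    rw [Finset.sum_congr rfl fun f _ => this f, ← Finset.sum_filter, Finset.sum_const,
      nsmul_eq_mul]
    congr 2
    unfold GraphOrientation.numLinExt GraphOrientation.LinExt
    rw [Nat.card_eq_fintype_card, Fintype.card_subtype]
  have hn : (n.factorial : ENNReal) ≠ 0 := by exact_mod_cast n.factorial_ne_zero
  rw [h1, h2, mul_assoc, mul_comm c, ENNReal.mul_div_right_comm,
    ENNReal.div_self hn (ENNReal.natCast_ne_top _), one_mul]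
end
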